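/- arXiv:2103.08092 — 2 statements merged into one kernel-verified Lean document; each statement's English description precedes it below -/
import Mathlib

section
/- Lemma 1 (prior mass of the Kullback–Leibler neighborhood). Under the clipped GLM setup, suppose a_n > 0, λ_n satisfies Assumption L₀, n, d_n → ∞ with d_n > n, n is large enough that b_n log d_n < n, and the true parameter β* belongs to B_{2,n}. Define D_n := { β ∈ ℝ^{d_n} : max( −E[L_n(η,η*)], Var[L_n(η,η*)] ) ≤ s_n* log d_n }, where expectation and variance are under the true data-generating distribution. Then, for all sufficiently large n, Π_n(D_n) ≥ C_n e^{−1/2} exp(−λ_n ||β*||₁) d_n^{−(a_n+4) s_n*}. -/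
open MeasureTheory Real Filter

noncomputable section

/-- Density of a one-parameter canonical exponential family member with
canonical parameter `θ`, base function `h`, sufficient statistic `T` and
log-partition function `A`. -/
def expFamDensity (h T A : ℝ → ℝ) (θ : ℝ) (y : ℝ) : ℝ :=
  h y * Real.exp (θ * T y - A θ)

/-- The exponential family member as a measure on `ℝ`. -/
def expFamMeasure (μ : Measure ℝ) (h T A : ℝ → ℝ) (θ : ℝ) : Measure ℝ :=
  μ.withDensity fun y => ENNReal.ofReal (expFamDensity h T A θ y)

/-- Joint distribution of `n` independent observations with parameters `θ i`. -/
def dataMeasure (μ : Measure ℝ) (h T A : ℝ → ℝ) (n : ℕ) (θ : Fin n → ℝ) :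
    Measure (Fin n → ℝ) :=
  Measure.pi fun i => expFamMeasure μ h T A (θ i)

/-- The ℓ₁ norm on `ℝ^m`. -/
def l1 {m : ℕ} (v : Fin m → ℝ) : ℝ := ∑ j, |v j|

/-- The support (set of nonzero coordinates) of a vector. -/
def suppSet {m : ℕ} (v : Fin m → ℝ) : Finset (Fin m) :=
  Finset.univ.filter fun j => v j ≠ 0

/-- `restr S v` agrees with `v` on `S` and is zero off `S`. -/
def restr {m : ℕ} (S : Finset (Fin m)) (v : Fin m → ℝ) : Fin m → ℝ :=
  fun j => if j ∈ S then v j else 0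

/-- The Laplace distribution with rate `lam` as a measure on `ℝ`. -/
def laplaceMeasure (lam : ℝ) : Measure ℝ :=
  volume.withDensity fun x => ENNReal.ofReal (lam / 2 * Real.exp (-(lam * |x|)))

/-- Given a model `S`, independent Laplace coordinates on `S` and point
masses at zero off `S`. -/
def modelMeasure (dn : ℕ) (lam : ℝ) (S : Finset (Fin dn)) : Measure (Fin dn → ℝ) :=
  Measure.pi fun j => if j ∈ S then laplaceMeasure lam else Measure.dirac 0

/-- The spike-and-Laplace complexity prior `Π_n` on `ℝ^{d_n}` with
hyperparameters `lam = λ_n`, `a = a_n` and normalizer `C = C_n`. -/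
def priorMeasure (dn : ℕ) (lam a C : ℝ) : Measure (Fin dn → ℝ) :=
  ∑ S : Finset (Fin dn),
    ENNReal.ofReal (C * ((dn.choose S.card : ℝ))⁻¹ * ((dn : ℝ) ^ (-a)) ^ S.card) •
      modelMeasure dn lam S

/-- `η_i = η(x_iᵀ β)`. -/
def etaVec (ηf : ℝ → ℝ) {n dn : ℕ} (X : Matrix (Fin n) (Fin dn) ℝ) (β : Fin dn → ℝ)
    (i : Fin n) : ℝ :=
  ηf (∑ j, X i j * β j)

/-- The Kullback--Leibler divergence `D_n(θ* ‖ θ)`, expressed as the Bregman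
divergence of the log-partition function. -/
def klDiv (A : ℝ → ℝ) {n : ℕ} (θstar θ : Fin n → ℝ) : ℝ :=
  ∑ i, (A (θ i) - A (θstar i) - (θ i - θstar i) * deriv A (θstar i))

/-- The centered stochastic term `Z_n(θ, θ*)`; `ET i` is the mean of `T(y_i)`. -/
def centeredZ (T : ℝ → ℝ) {n : ℕ} (ET θstar θ : Fin n → ℝ) (y : Fin n → ℝ) : ℝ :=
  ∑ i, (T (y i) - ET i) * (θ i - θstar i)

/-- The log-likelihood ratio `L_n(η, η*) = Z_n(η, η*) - D_n(η* ‖ η)`. -/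
def logLR (μ : Measure ℝ) (h T A ηf : ℝ → ℝ) {n dn : ℕ} (X : Matrix (Fin n) (Fin dn) ℝ)
    (βstar β : Fin dn → ℝ) (y : Fin n → ℝ) : ℝ :=
  centeredZ T (fun i => ∫ z, T z ∂(expFamMeasure μ h T A (etaVec ηf X βstar i)))
      (etaVec ηf X βstar) (etaVec ηf X β) y
    - klDiv A (etaVec ηf X βstar) (etaVec ηf X β)

/-- The marginal likelihood `∫ exp(L_n(η,η*)) dΠ_n(β)`. -/
def marginalLik (μ : Measure ℝ) (h T A ηf : ℝ → ℝ) {n : ℕ} (dn : ℕ)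
    (X : Matrix (Fin n) (Fin dn) ℝ) (βstar : Fin dn → ℝ) (lam a C : ℝ)
    (y : Fin n → ℝ) : ℝ :=
  ∫ β, Real.exp (logLR μ h T A ηf X βstar β y) ∂(priorMeasure dn lam a C)

/-- The posterior probability of a set `B` given data `y`. -/
def posterior (μ : Measure ℝ) (h T A ηf : ℝ → ℝ) {n : ℕ} (dn : ℕ)
    (X : Matrix (Fin n) (Fin dn) ℝ) (βstar : Fin dn → ℝ) (lam a C : ℝ)
    (B : Set (Fin dn → ℝ)) (y : Fin n → ℝ) : ℝ :=
  (∫ β in B, Real.exp (logLR μ h T A ηf X βstar β y) ∂(priorMeasure dn lam a C)) /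
    marginalLik μ h T A ηf dn X βstar lam a C y

/-- `‖X‖_{(∞,∞)} = max_{i,j} |X_{ij}|`. -/
def Xnorm {n dn : ℕ} (X : Matrix (Fin n) (Fin dn) ℝ) : ℝ := ⨆ i, ⨆ j, |X i j|

/-- `M(A, X) = ‖X‖_{(∞,∞)} · M₁(A)` with `M₁(A) = (1 ⊓ M₀(A)⁻¹)⁻¹`. -/
def Mconst (M0 : ℝ) {n dn : ℕ} (X : Matrix (Fin n) (Fin dn) ℝ) : ℝ :=
  Xnorm X * (min 1 M0⁻¹)⁻¹

/-- The base measure `h · μ` of the exponential family. -/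
def baseMeasure (μ : Measure ℝ) (h : ℝ → ℝ) : Measure ℝ :=
  μ.withDensity fun y => ENNReal.ofReal (h y)

theorem mgf_baseMeasure {μ : Measure ℝ} {h T : ℝ → ℝ} (hhpos : ∀ y, 0 ≤ h y)
    (hmh : Measurable h) (θ : ℝ) :
    ProbabilityTheory.mgf T (baseMeasure μ h) θ = ∫ y, h y * Real.exp (θ * T y) ∂μ := by
  rw [ProbabilityTheory.mgf, baseMeasure,
    integral_withDensity_eq_integral_toReal_smul hmh.ennreal_ofReal (by simp)]
  simp [ENNReal.toReal_ofReal (hhpos _)]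

theorem expFamMeasure_eq_tilted {μ : Measure ℝ} {h T A : ℝ → ℝ} (hhpos : ∀ y, 0 ≤ h y)
    (hmh : Measurable h) (hmT : Measurable T) {θ : ℝ}
    (hθ : Real.exp (A θ) = ∫ y, h y * Real.exp (θ * T y) ∂μ) :
    expFamMeasure μ h T A θ = (baseMeasure μ h).tilted (fun y => θ * T y) := by
  have hm := mgf_baseMeasure (μ := μ) (T := T) hhpos hmh θ
  rw [← hθ, ProbabilityTheory.mgf] at hm
  rw [Measure.tilted, hm, baseMeasure, ← withDensity_mul _ hmh.ennreal_ofReal (by fun_prop),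
    expFamMeasure]
  congr 1
  ext y
  simp only [expFamDensity, Pi.mul_apply]
  rw [← ENNReal.ofReal_mul (hhpos y), Real.exp_sub]

theorem subset_integrableExpSet {μ : Measure ℝ} {h T A : ℝ → ℝ} {domA : Set ℝ}
    (hhpos : ∀ y, 0 ≤ h y) (hmh : Measurable h)
    (hlogpart : ∀ θ ∈ domA, Real.exp (A θ) = ∫ y, h y * Real.exp (θ * T y) ∂μ) :
    domA ⊆ ProbabilityTheory.integrableExpSet T (baseMeasure μ h) := by
  intro θ hθ
  by_contra hc
  have := mgf_baseMeasure (μ := μ) (T := T) hhpos hmh θ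
  rw [← hlogpart θ hθ, ProbabilityTheory.mgf_undef hc] at this
  exact (Real.exp_pos _).ne this

theorem eventuallyEq_cgf {μ : Measure ℝ} {h T A : ℝ → ℝ} {domA : Set ℝ}
    (hhpos : ∀ y, 0 ≤ h y) (hmh : Measurable h)
    (hlogpart : ∀ θ ∈ domA, Real.exp (A θ) = ∫ y, h y * Real.exp (θ * T y) ∂μ)
    {θ : ℝ} (hθ : θ ∈ interior domA) :
    A =ᶠ[nhds θ] ProbabilityTheory.cgf T (baseMeasure μ h) := by
  filter_upwards [mem_interior_iff_mem_nhds.1 hθ] with x hx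
  rw [ProbabilityTheory.cgf, mgf_baseMeasure hhpos hmh, ← hlogpart x hx, Real.log_exp]

/-- The variance of the sufficient statistic is the second derivative of the log-partition
function. -/
theorem variance_expFamMeasure {μ : Measure ℝ} {h T A : ℝ → ℝ} {domA : Set ℝ}
    (hhpos : ∀ y, 0 ≤ h y) (hmh : Measurable h) (hmT : Measurable T)
    (hlogpart : ∀ θ ∈ domA, Real.exp (A θ) = ∫ y, h y * Real.exp (θ * T y) ∂μ)
    {θ : ℝ} (hθ : θ ∈ interior domA) :
    MemLp T 2 (expFamMeasure μ h T A θ) ∧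
      ProbabilityTheory.variance T (expFamMeasure μ h T A θ) = deriv (deriv A) θ := by
  have hint := interior_mono (subset_integrableExpSet (T := T) hhpos hmh hlogpart) hθ
  rw [expFamMeasure_eq_tilted hhpos hmh hmT (hlogpart θ (interior_subset hθ))]
  refine ⟨by simpa using ProbabilityTheory.memLp_tilted_mul hint 2, ?_⟩
  rw [ProbabilityTheory.variance_tilted_mul hint, iteratedDeriv_succ, iteratedDeriv_one]
  exact (eventuallyEq_cgf hhpos hmh hlogpart hθ).deriv.deriv_eq.symm

theorem analyticAt_logPartition {μ : Measure ℝ} {h T A : ℝ → ℝ} {domA : Set ℝ}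
    (hhpos : ∀ y, 0 ≤ h y) (hmh : Measurable h)
    (hlogpart : ∀ θ ∈ domA, Real.exp (A θ) = ∫ y, h y * Real.exp (θ * T y) ∂μ)
    {θ : ℝ} (hθ : θ ∈ interior domA) : AnalyticAt ℝ A θ :=
  (ProbabilityTheory.analyticAt_cgf
    (interior_mono (subset_integrableExpSet (T := T) hhpos hmh hlogpart) hθ)).congr
    (eventuallyEq_cgf hhpos hmh hlogpart hθ).symm

/-- A continuous injective real function with values in a convex set takes values in its
interior. -/
theorem mem_interior_of_injective {f : ℝ → ℝ} {s : Set ℝ} (hs : Convex ℝ s)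
    (hf : Continuous f) (hinj : Function.Injective f) (hfs : ∀ t, f t ∈ s) (t : ℝ) :
    f t ∈ interior s := by
  rw [mem_interior_iff_mem_nhds]
  rcases hf.strictMono_of_inj hinj with hm | hm
  · exact Filter.mem_of_superset (Icc_mem_nhds (hm (sub_one_lt t)) (hm (lt_add_one t)))
      (hs.ordConnected.out (hfs _) (hfs _))
  · exact Filter.mem_of_superset (Icc_mem_nhds (hm (lt_add_one t)) (hm (sub_one_lt t)))
      (hs.ordConnected.out (hfs _) (hfs _))

/-- A convex differentiable function lies above its tangent lines. -/
theorem tangent_le_of_convexOn {f : ℝ → ℝ} {s : Set ℝ} (hf : ConvexOn ℝ s f) {x y f' : ℝ}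
    (hx : x ∈ s) (hy : y ∈ s) (hd : HasDerivAt f f' x) : f x + f' * (y - x) ≤ f y := by
  rcases lt_trichotomy x y with h | rfl | h
  · have := hf.le_slope_of_hasDerivAt hx hy h hd
    rw [slope_def_field, le_div_iff₀ (sub_pos.2 h)] at this
    linarith
  · simp
  · have := hf.slope_le_of_hasDerivAt hy hx h hd
    rw [slope_def_field, div_le_iff₀ (sub_pos.2 h)] at this
    linarith

/-- Quadratic upper bound on a Bregman divergence from a bound on the second derivative. -/
theorem bregman_le_of_deriv2_le {A : ℝ → ℝ} {s : Set ℝ} (hs : Convex ℝ s) {c : ℝ}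
    (hA : ∀ x ∈ s, AnalyticAt ℝ A x) (hc : ∀ x ∈ s, deriv (deriv A) x ≤ c) {x y : ℝ}
    (hx : x ∈ s) (hy : y ∈ s) :
    A y - A x - (y - x) * deriv A x ≤ c / 2 * (y - x) ^ 2 := by
  have hq : ∀ z, AnalyticAt ℝ A z →
      HasDerivAt (fun t => c / 2 * t ^ 2 - A t) (c * z - deriv A z) z := by
    intro z hz
    refine (((hasDerivAt_pow 2 z).const_mul (c / 2)).fun_sub
      hz.differentiableAt.hasDerivAt).congr_deriv ?_
    push_cast
    ring
  have hd := fun z hz => hq z (hA z hz)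
  have hev : ∀ z ∈ s, deriv (fun t => c / 2 * t ^ 2 - A t) =ᶠ[nhds z]
      fun t => c * t - deriv A t := by
    intro z hz
    filter_upwards [(hA z hz).eventually_analyticAt] with w hw
    exact (hq w hw).deriv
  have hd2 : ∀ z ∈ s, HasDerivAt (deriv fun t => c / 2 * t ^ 2 - A t)
      (c - deriv (deriv A) z) z := by
    intro z hz
    have h1 := ((hasDerivAt_id z).const_mul c).sub (hA z hz).deriv.differentiableAt.hasDerivAt
    rw [mul_one] at h1
    exact h1.congr_of_eventuallyEq (hev z hz)
  have hconv : ConvexOn ℝ s (fun t => c / 2 * t ^ 2 - A t) := by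
    refine convexOn_of_deriv2_nonneg' hs
      (fun z hz => (hd z hz).differentiableAt.differentiableWithinAt)
      (fun z hz => (hd2 z hz).differentiableAt.differentiableWithinAt) fun z hz => ?_
    rw [Function.iterate_succ, Function.iterate_one, Function.comp_apply, (hd2 z hz).deriv]
    linarith [hc z hz]
  have := tangent_le_of_convexOn hconv hx hy (hd x hx)
  linarith

/-- The centered stochastic term has mean zero, and its second moment is the weighted sum of the
marginal variances. -/
theorem integral_centeredZ {n : ℕ} {T : ℝ → ℝ} (P : Fin n → Measure ℝ)
    [∀ i, IsProbabilityMeasure (P i)] (hT : ∀ i, MemLp T 2 (P i)) (θstar θ : Fin n → ℝ) :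
    Integrable (centeredZ T (fun i => ∫ z, T z ∂(P i)) θstar θ) (Measure.pi P) ∧
    ∫ y, centeredZ T (fun i => ∫ z, T z ∂(P i)) θstar θ y ∂(Measure.pi P) = 0 ∧
    ∫ y, (centeredZ T (fun i => ∫ z, T z ∂(P i)) θstar θ y) ^ 2 ∂(Measure.pi P) =
      ∑ i, (θ i - θstar i) ^ 2 * ProbabilityTheory.variance T (P i) := by
  set Y : Fin n → ℝ → ℝ := fun i t => (T t - ∫ z, T z ∂(P i)) * (θ i - θstar i) with hY
  have hYL : ∀ i, MemLp (Y i) 2 (P i) := fun i =>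
    ((hT i).sub (memLp_const _)).mul_const _
  have hYi : ∀ i, Integrable (Y i) (P i) := fun i => (hYL i).integrable (by norm_num)
  have hTi : ∀ i, Integrable T (P i) := fun i => (hT i).integrable (by norm_num)
  have hZ : centeredZ T (fun i => ∫ z, T z ∂(P i)) θstar θ = ∑ i, fun y => Y i (y i) := by
    ext y
    simp [centeredZ, hY]
  have hi : ∀ i, Integrable (fun y : Fin n → ℝ => Y i (y i)) (Measure.pi P) :=
    fun i => integrable_comp_eval (hYi i)
  have hint : Integrable (centeredZ T (fun i => ∫ z, T z ∂(P i)) θstar θ) (Measure.pi P) := by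
    rw [hZ]
    exact integrable_finsetSum' _ fun i _ => hi i
  have hmean : ∫ y, centeredZ T (fun i => ∫ z, T z ∂(P i)) θstar θ y ∂(Measure.pi P) = 0 := by
    simp_rw [hZ, Finset.sum_apply]
    rw [integral_finsetSum _ fun i _ => hi i]
    refine Finset.sum_eq_zero fun i _ => ?_
    rw [integral_comp_eval (hYL i).aestronglyMeasurable, hY]
    simp only
    rw [integral_mul_const, integral_sub (hTi i) (integrable_const _)]
    simp
  refine ⟨hint, hmean, ?_⟩
  have hvar := ProbabilityTheory.variance_of_integral_eq_zero hint.aemeasurable hmean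
  rw [← hvar, hZ, ProbabilityTheory.variance_sum_pi hYL]
  refine Finset.sum_congr rfl fun i _ => ?_
  simp only [hY]
  simp_rw [mul_comm _ (θ i - θstar i)]
  rw [ProbabilityTheory.variance_const_mul,
    ProbabilityTheory.variance_sub_const (hT i).aestronglyMeasurable]

theorem abs_le_Xnorm {n dn : ℕ} (X : Matrix (Fin n) (Fin dn) ℝ) (i : Fin n) (j : Fin dn) :
    |X i j| ≤ Xnorm X :=
  (le_ciSup (Set.finite_range fun j => |X i j|).bddAbove j).trans
    (le_ciSup (Set.finite_range fun i => ⨆ j, |X i j|).bddAbove i)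

theorem Xnorm_nonneg {n dn : ℕ} (X : Matrix (Fin n) (Fin dn) ℝ) : 0 ≤ Xnorm X :=
  Real.iSup_nonneg fun _ => Real.iSup_nonneg fun _ => abs_nonneg _

theorem abs_etaVec_sub_le {ηf : ℝ → ℝ} (hlip : LipschitzWith 1 ηf) {n dn : ℕ}
    (X : Matrix (Fin n) (Fin dn) ℝ) (β β' : Fin dn → ℝ) (i : Fin n) :
    |etaVec ηf X β i - etaVec ηf X β' i| ≤ Xnorm X * l1 (β - β') := by
  have h1 := hlip.dist_le_mul (∑ j, X i j * β j) (∑ j, X i j * β' j)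
  rw [Real.dist_eq, Real.dist_eq, NNReal.coe_one, one_mul] at h1
  refine h1.trans ?_
  rw [← Finset.sum_sub_distrib, l1, Finset.mul_sum]
  refine (Finset.abs_sum_le_sum_abs _ _).trans (Finset.sum_le_sum fun j _ => ?_)
  rw [← mul_sub, abs_mul, Pi.sub_apply]
  exact mul_le_mul_of_nonneg_right (abs_le_Xnorm X i j) (abs_nonneg _)

theorem Xnorm_mul_le_Mconst {M0 : ℝ} (hM0 : 0 < M0) {n dn : ℕ}
    (X : Matrix (Fin n) (Fin dn) ℝ) : Xnorm X * M0 ≤ Mconst M0 X := by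
  refine mul_le_mul_of_nonneg_left ?_ (Xnorm_nonneg X)
  rw [le_inv_comm₀ hM0 (lt_min one_pos (inv_pos.2 hM0))]
  exact min_le_right _ _

/-- Kullback--Leibler divergence and variance of the log-likelihood ratio of a clipped generalized
linear model are controlled by the `ℓ₁` distance to the true parameter. -/
theorem logLR_moments_le
    {μ : Measure ℝ} {h T A ηf : ℝ → ℝ} {M0 : ℝ}
    {domA : Set ℝ} (hdomA : Convex ℝ domA) (hrange : ∀ t : ℝ, ηf t ∈ domA)
    (hhpos : ∀ y, 0 ≤ h y) (hmh : Measurable h) (hmT : Measurable T)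
    (hlogpart : ∀ θ ∈ domA, Real.exp (A θ) = ∫ y, h y * Real.exp (θ * T y) ∂μ)
    (hprob : ∀ θ ∈ domA, IsProbabilityMeasure (expFamMeasure μ h T A θ))
    (hclip : ∀ t : ℝ, deriv (deriv A) (ηf t) ≤ M0 ^ 2 / 2)
    (hlip : LipschitzWith 1 ηf) (hinj : Function.Injective ηf) {n dn : ℕ}
    (X : Matrix (Fin n) (Fin dn) ℝ) (βstar β : Fin dn → ℝ) :
    max (-(∫ y, logLR μ h T A ηf X βstar β y
            ∂(dataMeasure μ h T A n (etaVec ηf X βstar))))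
        (∫ y, (logLR μ h T A ηf X βstar β y -
            ∫ y', logLR μ h T A ηf X βstar β y'
              ∂(dataMeasure μ h T A n (etaVec ηf X βstar))) ^ 2
          ∂(dataMeasure μ h T A n (etaVec ηf X βstar))) ≤
      n / 2 * (M0 * Xnorm X * l1 (β - βstar)) ^ 2 := by
  have hmem := mem_interior_of_injective hdomA hlip.continuous hinj hrange
  have hP : ∀ i, IsProbabilityMeasure (expFamMeasure μ h T A (etaVec ηf X βstar i)) :=
    fun i => hprob _ (hrange _)
  have hV : ∀ i, _ := fun i : Fin n => variance_expFamMeasure hhpos hmh hmT hlogpart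
    (hmem (∑ j, X i j * βstar j))
  obtain ⟨hZi, hZ0, hZ2⟩ := integral_centeredZ
    (fun i => expFamMeasure μ h T A (etaVec ηf X βstar i)) (fun i => (hV i).1)
    (etaVec ηf X βstar) (etaVec ηf X β)
  have hprobPi : IsProbabilityMeasure (dataMeasure μ h T A n (etaVec ηf X βstar)) := by
    unfold dataMeasure
    infer_instance
  have hmean : ∫ y, logLR μ h T A ηf X βstar β y
      ∂(dataMeasure μ h T A n (etaVec ηf X βstar)) =
      -klDiv A (etaVec ηf X βstar) (etaVec ηf X β) := by
    unfold logLR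
    change Integrable _ (dataMeasure μ h T A n (etaVec ηf X βstar)) at hZi
    rw [integral_sub hZi (integrable_const _), dataMeasure, hZ0]
    simp
  have hsq : ∀ i, (etaVec ηf X β i - etaVec ηf X βstar i) ^ 2 ≤
      (Xnorm X * l1 (β - βstar)) ^ 2 := fun i => by
    rw [← sq_abs]
    exact pow_le_pow_left₀ (abs_nonneg _) (abs_etaVec_sub_le hlip X β βstar i) 2
  refine max_le ?_ ?_
  · rw [hmean, neg_neg, klDiv]
    have hterm : ∀ i ∈ (Finset.univ : Finset (Fin n)),
        A (etaVec ηf X β i) - A (etaVec ηf X βstar i) -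
          (etaVec ηf X β i - etaVec ηf X βstar i) * deriv A (etaVec ηf X βstar i) ≤
        M0 ^ 2 / 2 * (Xnorm X * l1 (β - βstar)) ^ 2 := by
      intro i _
      have hb := bregman_le_of_deriv2_le (A := A) (s := Set.range ηf)
        (isPreconnected_range hlip.continuous).ordConnected.convex
        (c := M0 ^ 2 / 2) (by
          rintro _ ⟨t, rfl⟩
          exact analyticAt_logPartition hhpos hmh hlogpart (hmem t)) (by
          rintro _ ⟨t, rfl⟩
          exact hclip t)
        (x := etaVec ηf X βstar i) (y := etaVec ηf X β i) ⟨_, rfl⟩ ⟨_, rfl⟩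
      refine hb.trans ?_
      have := hsq i
      gcongr
      linarith [sq_nonneg M0]
    refine (Finset.sum_le_card_nsmul _ _ _ hterm).trans (le_of_eq ?_)
    simp
    ring
  · rw [hmean]
    simp only [logLR, sub_neg_eq_add, sub_add_cancel]
    rw [dataMeasure, hZ2]
    have hterm : ∀ i ∈ (Finset.univ : Finset (Fin n)),
        (etaVec ηf X β i - etaVec ηf X βstar i) ^ 2 *
          ProbabilityTheory.variance T (expFamMeasure μ h T A (etaVec ηf X βstar i)) ≤
        (Xnorm X * l1 (β - βstar)) ^ 2 * (M0 ^ 2 / 2) := by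
      intro i _
      refine mul_le_mul (hsq i) ?_ (ProbabilityTheory.variance_nonneg _ _) (sq_nonneg _)
      exact (hV i).2.trans_le (hclip _)
    refine (Finset.sum_le_card_nsmul _ _ _ hterm).trans (le_of_eq ?_)
    simp
    ring

instance (lam : ℝ) : SigmaFinite (laplaceMeasure lam) := by
  unfold laplaceMeasure
  infer_instance

theorem laplaceMeasure_Icc_ge {lam ρ : ℝ} (hlam : 0 ≤ lam) (b : ℝ) :
    ENNReal.ofReal (lam * ρ * Real.exp (-(lam * ρ)) * Real.exp (-(lam * |b|))) ≤
      laplaceMeasure lam (Set.Icc (b - ρ) (b + ρ)) := by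
  rw [laplaceMeasure, withDensity_apply _ measurableSet_Icc]
  calc ENNReal.ofReal (lam * ρ * Real.exp (-(lam * ρ)) * Real.exp (-(lam * |b|)))
      = ∫⁻ _ in Set.Icc (b - ρ) (b + ρ),
          ENNReal.ofReal (lam / 2 * Real.exp (-(lam * (|b| + ρ)))) := by
        rw [setLIntegral_const, Real.volume_Icc, ← ENNReal.ofReal_mul (by positivity)]
        congr 1
        rw [mul_add, neg_add, Real.exp_add]
        ring
    _ ≤ ∫⁻ x in Set.Icc (b - ρ) (b + ρ),
          ENNReal.ofReal (lam / 2 * Real.exp (-(lam * |x|))) := by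
        refine setLIntegral_mono' measurableSet_Icc fun x hx => ?_
        have : |x| ≤ |b| + ρ := by
          have h1 : |x - b| ≤ ρ := abs_le.2 ⟨by linarith [hx.1], by linarith [hx.2]⟩
          linarith [abs_sub_abs_le_abs_sub x b]
        gcongr

/-- The coordinate box of radius `ρ` around `v` inside the coordinate subspace of `supp v`. -/
def suppBox {m : ℕ} (v : Fin m → ℝ) (ρ : ℝ) : Set (Fin m → ℝ) :=
  Set.univ.pi fun j => if j ∈ suppSet v then Set.Icc (v j - ρ) (v j + ρ) else {0}

theorem l1_sub_le_of_mem_suppBox {m : ℕ} {v β : Fin m → ℝ} {ρ : ℝ} (hβ : β ∈ suppBox v ρ) :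
    l1 (β - v) ≤ (suppSet v).card * ρ := by
  have hterm : ∀ j, |(β - v) j| ≤ if j ∈ suppSet v then ρ else 0 := by
    intro j
    have hj := hβ j trivial
    by_cases hs : j ∈ suppSet v
    · simp only [hs, if_true] at hj ⊢
      exact abs_le.2 ⟨by rw [Pi.sub_apply]; linarith [hj.1], by rw [Pi.sub_apply]; linarith [hj.2]⟩
    · simp only [hs, if_false, Set.mem_singleton_iff] at hj ⊢
      have hv : v j = 0 := by simpa [suppSet] using hs
      simp [hj, hv]
  refine (Finset.sum_le_sum fun j _ => hterm j).trans (le_of_eq ?_)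
  simp

theorem modelMeasure_suppBox_ge {m : ℕ} (v : Fin m → ℝ) {lam ρ : ℝ} (hlam : 0 ≤ lam)
    (hρ : 0 ≤ ρ) :
    ENNReal.ofReal ((lam * ρ * Real.exp (-(lam * ρ))) ^ (suppSet v).card *
      Real.exp (-lam * l1 v)) ≤ modelMeasure m lam (suppSet v) (suppBox v ρ) := by
  have hσ : ∀ j : Fin m, SigmaFinite
      (if j ∈ suppSet v then laplaceMeasure lam else Measure.dirac 0) := by
    intro j
    split_ifs <;> infer_instance
  have hl1 : l1 v = ∑ j ∈ suppSet v, |v j| := by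
    rw [l1, suppSet, Finset.sum_filter]
    refine Finset.sum_congr rfl fun j _ => ?_
    split_ifs with hj
    · rfl
    · simp [not_not.1 hj]
  rw [modelMeasure, suppBox, Measure.pi_pi]
  calc ENNReal.ofReal ((lam * ρ * Real.exp (-(lam * ρ))) ^ (suppSet v).card *
        Real.exp (-lam * l1 v))
      = ∏ j ∈ suppSet v,
          ENNReal.ofReal (lam * ρ * Real.exp (-(lam * ρ)) * Real.exp (-(lam * |v j|))) := by
        rw [← ENNReal.ofReal_prod_of_nonneg fun j _ => by positivity, Finset.prod_mul_distrib,
          Finset.prod_const, ← Real.exp_sum, hl1, Finset.mul_sum]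
        simp
    _ ≤ ∏ j ∈ suppSet v, laplaceMeasure lam (Set.Icc (v j - ρ) (v j + ρ)) :=
        Finset.prod_le_prod' fun j _ => laplaceMeasure_Icc_ge hlam (v j)
    _ = _ := by
        rw [← Finset.prod_filter_mul_prod_filter_not Finset.univ (· ∈ suppSet v)]
        rw [Finset.prod_congr rfl (g := fun _ => (1 : ENNReal)) (s₁ := Finset.univ.filter
          (· ∉ suppSet v)) fun j hj => by simp [(Finset.mem_filter.1 hj).2]]
        rw [Finset.prod_const_one, mul_one, Finset.filter_univ_mem]
        exact Finset.prod_congr rfl fun j hj => by simp [hj]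

theorem le_priorMeasure {m : ℕ} (lam a C : ℝ) (S : Finset (Fin m)) (B : Set (Fin m → ℝ)) :
    ENNReal.ofReal (C * ((m.choose S.card : ℝ))⁻¹ * ((m : ℝ) ^ (-a)) ^ S.card) *
      modelMeasure m lam S B ≤ priorMeasure m lam a C B := by
  rw [priorMeasure, Measure.finsetSum_apply]
  exact Finset.single_le_sum (f := fun S : Finset (Fin m) =>
    (ENNReal.ofReal (C * ((m.choose S.card : ℝ))⁻¹ * ((m : ℝ) ^ (-a)) ^ S.card) •
      modelMeasure m lam S) B) (fun _ _ => zero_le) (Finset.mem_univ S)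

/-- The normalizing constant of a probability prior is at most one. -/
theorem normalizer_le_one {m : ℕ} {lam a C : ℝ}
    [IsProbabilityMeasure (priorMeasure m lam a C)] : C ≤ 1 := by
  have h1 := le_priorMeasure lam a C (∅ : Finset (Fin m)) Set.univ
  have h2 : modelMeasure m lam ∅ Set.univ = 1 := by
    simp only [modelMeasure, Finset.notMem_empty, if_false]
    exact measure_univ
  rw [h2, measure_univ] at h1
  simpa using h1

theorem priorMeasure_suppBox_ge {m : ℕ} (hm : 2 ≤ m) (v : Fin m → ℝ) {lam a C : ℝ}
    (hlam : 0 < lam) (hC : 0 < C) :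
    ENNReal.ofReal (C * Real.exp (-(1 : ℝ) / 2) * Real.exp (-lam * l1 v) *
        (m : ℝ) ^ (-((a + 4) * ((suppSet v).card : ℝ)))) ≤
      priorMeasure m lam a C (suppBox v (lam⁻¹ * ((m : ℝ) ^ 2)⁻¹)) := by
  set s := (suppSet v).card with hs
  have hm2 : (2 : ℝ) ≤ m := by exact_mod_cast hm
  have hm0 : (0 : ℝ) < m := by linarith
  refine le_trans ?_ (le_priorMeasure lam a C (suppSet v) _)
  refine le_trans ?_ (mul_le_mul_right (modelMeasure_suppBox_ge v hlam.le (by positivity)) _)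
  rw [← ENNReal.ofReal_mul (by positivity), ← hs, mul_inv_cancel_left₀ hlam.ne']
  refine ENNReal.ofReal_le_ofReal ?_
  have hκ : ((m : ℝ) ^ 3)⁻¹ ≤ ((m : ℝ) ^ 2)⁻¹ * Real.exp (-((m : ℝ) ^ 2)⁻¹) := by
    have h1 : ((m : ℝ))⁻¹ ≤ Real.exp (-((m : ℝ) ^ 2)⁻¹) := by
      refine le_trans ?_ (Real.add_one_le_exp _)
      have hi : (m : ℝ)⁻¹ ≤ 2⁻¹ := inv_anti₀ two_pos hm2
      have hi0 : 0 < (m : ℝ)⁻¹ := by positivity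
      rw [← inv_pow]
      nlinarith
    calc ((m : ℝ) ^ 3)⁻¹ = ((m : ℝ) ^ 2)⁻¹ * (m : ℝ)⁻¹ := by rw [pow_succ, mul_inv]
      _ ≤ _ := by gcongr
  have hch : ((m : ℝ) ^ s)⁻¹ ≤ ((m.choose s : ℝ))⁻¹ := by
    have hsm : s ≤ m := by simpa using Finset.card_le_univ (suppSet v)
    refine inv_anti₀ (by exact_mod_cast Nat.choose_pos hsm) ?_
    exact_mod_cast Nat.choose_le_pow m s
  have hpow : (m : ℝ) ^ (-((a + 4) * (s : ℝ))) =
      ((m : ℝ) ^ s)⁻¹ * ((m : ℝ) ^ (-a)) ^ s * (((m : ℝ) ^ 3)⁻¹) ^ s := by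
    rw [← mul_neg_one, mul_right_comm, Real.rpow_mul_natCast hm0.le, ← inv_pow, ← mul_pow,
      ← mul_pow]
    congr 1
    rw [show (a + 4) * -1 = -a + -((4 : ℕ) : ℝ) by push_cast; ring, Real.rpow_add hm0,
      Real.rpow_neg hm0.le ((4 : ℕ) : ℝ), Real.rpow_natCast]
    field_simp
  rw [hpow]
  calc C * Real.exp (-(1 : ℝ) / 2) * Real.exp (-lam * l1 v) *
        (((m : ℝ) ^ s)⁻¹ * ((m : ℝ) ^ (-a)) ^ s * (((m : ℝ) ^ 3)⁻¹) ^ s)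
      ≤ C * 1 * Real.exp (-lam * l1 v) * (((m.choose s : ℝ))⁻¹ * ((m : ℝ) ^ (-a)) ^ s *
          (((m : ℝ) ^ 2)⁻¹ * Real.exp (-((m : ℝ) ^ 2)⁻¹)) ^ s) := by
        gcongr
        exact Real.exp_le_one_iff.2 (by norm_num)
    _ = _ := by ring

/-- **Lemma 1** (prior mass of the Kullback–Leibler neighborhood `D_n`). -/
theorem lemma1_prior_mass_KL_neighborhood
    (μ : Measure ℝ) [SigmaFinite μ]
    (h T A ηf : ℝ → ℝ) (M0 : ℝ) (hM0 : 0 < M0)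
    (domA : Set ℝ) (hdomA : Convex ℝ domA) (hrange : ∀ t : ℝ, ηf t ∈ domA)
    (hconv : ConvexOn ℝ domA A) (hsmooth : ContDiffOn ℝ 2 A domA)
    (hhpos : ∀ y, 0 ≤ h y) (hmh : Measurable h) (hmT : Measurable T)
    (hlogpart : ∀ θ ∈ domA, Real.exp (A θ) = ∫ y, h y * Real.exp (θ * T y) ∂μ)
    (hprob : ∀ θ ∈ domA, IsProbabilityMeasure (expFamMeasure μ h T A θ))
    (hIA : ∀ c : ℝ, 0 < c →
      ({t : ℝ | 0 ≤ deriv (deriv A) t ∧ deriv (deriv A) t ≤ c} : Set ℝ).OrdConnected)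
    (hIAtop : ({t : ℝ | 0 ≤ deriv (deriv A) t} : Set ℝ).OrdConnected)
    (hclip : ∀ t : ℝ, 0 ≤ deriv (deriv A) (ηf t) ∧ deriv (deriv A) (ηf t) ≤ M0 ^ 2 / 2)
    (hlip : LipschitzWith 1 ηf) (hinj : Function.Injective ηf)
    (d : ℕ → ℕ) (hdgt : ∀ n, n < d n)
    (hdinf : Tendsto (fun n => (d n : ℝ)) atTop atTop)
    (b : ℕ → ℝ) (hbpos : ∀ n, 0 < b n)
    (hbo : Tendsto (fun n => b n * Real.log (d n) / n) atTop (nhds 0))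
    (X : ∀ n : ℕ, Matrix (Fin n) (Fin (d n)) ℝ)
    (lam a C : ℕ → ℝ) (hCpos : ∀ n, 0 < C n)
    (hL0 : ∀ n, Mconst M0 (X n) / (d n : ℝ) ≤ lam n ∧
      lam n ≤ Mconst M0 (X n) * Real.sqrt (Real.log (d n)))
    (hprior : ∀ n, IsProbabilityMeasure (priorMeasure (d n) (lam n) (a n) (C n)))
    (ha : ∀ n, 0 < a n)
    (βstar : ∀ n : ℕ, Fin (d n) → ℝ)
    (hβstar : ∀ n, 0 < (suppSet (βstar n)).card ∧ ((suppSet (βstar n)).card : ℝ) ≤ b n) :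
    ∀ᶠ n in atTop,
      ENNReal.ofReal (C n * Real.exp (-(1 : ℝ) / 2) * Real.exp (-(lam n) * l1 (βstar n)) *
          (d n : ℝ) ^ (-((a n + 4) * ((suppSet (βstar n)).card : ℝ)))) ≤
        priorMeasure (d n) (lam n) (a n) (C n)
          {β : Fin (d n) → ℝ |
            max (-(∫ y, logLR μ h T A ηf (X n) (βstar n) β y
                    ∂(dataMeasure μ h T A n (etaVec ηf (X n) (βstar n)))))
              (∫ y, (logLR μ h T A ηf (X n) (βstar n) β y -
                  ∫ y', logLR μ h T A ηf (X n) (βstar n) β y'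
                    ∂(dataMeasure μ h T A n (etaVec ηf (X n) (βstar n)))) ^ 2
                ∂(dataMeasure μ h T A n (etaVec ηf (X n) (βstar n)))) ≤
            ((suppSet (βstar n)).card : ℝ) * Real.log (d n)} := by
  filter_upwards [eventually_ge_atTop 2] with n hn
  have hd3 : 3 ≤ d n := hn.trans_lt (hdgt n)
  have hd3' : (3 : ℝ) ≤ d n := by exact_mod_cast hd3
  have hd0 : (0 : ℝ) < d n := by linarith
  have hnd : (n : ℝ) ≤ d n := by exact_mod_cast (hdgt n).le
  have hlog : 1 ≤ Real.log (d n) := by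
    rw [Real.le_log_iff_exp_le hd0]
    linarith [Real.exp_one_lt_d9]
  set s := (suppSet (βstar n)).card with hs
  have hs0 : (0 : ℝ) ≤ s := Nat.cast_nonneg _
  have hsd : (s : ℝ) ≤ d n := by
    exact_mod_cast (show s ≤ d n by simpa using Finset.card_le_univ (suppSet (βstar n)))
  have hsub : ∀ β, n / 2 * (M0 * Xnorm (X n) * l1 (β - βstar n)) ^ 2 ≤ s * Real.log (d n) → _ :=
    fun β hβ => (logLR_moments_le (A := A) hdomA hrange hhpos hmh hmT hlogpart hprob
      (fun t => (hclip t).2) hlip hinj (X n) (βstar n) β).trans hβ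
  have hX0 := Xnorm_nonneg (X n)
  have hXM := Xnorm_mul_le_Mconst hM0 (X n)
  rcases hX0.eq_or_lt with hX | hX
  · have := hprior n
    refine le_trans ?_ (measure_mono (s := Set.univ) fun β _ => hsub β (by
      rw [← hX, mul_zero, zero_mul, zero_pow two_ne_zero, mul_zero]
      positivity))
    rw [measure_univ, ENNReal.ofReal_le_one]
    have hlam : 0 ≤ lam n := by
      refine le_trans (le_of_eq ?_) (hL0 n).1
      simp [Mconst, ← hX]
    have hl1 : 0 ≤ l1 (βstar n) := Finset.sum_nonneg fun _ _ => abs_nonneg _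
    have h2 : Real.exp (-(1 : ℝ) / 2) ≤ 1 := Real.exp_le_one_iff.2 (by norm_num)
    have h3 : Real.exp (-(lam n) * l1 (βstar n)) ≤ 1 :=
      Real.exp_le_one_iff.2 (by nlinarith [mul_nonneg hlam hl1])
    have h4 : (d n : ℝ) ^ (-((a n + 4) * (s : ℝ))) ≤ 1 :=
      Real.rpow_le_one_of_one_le_of_nonpos (by linarith)
        (neg_nonpos.2 (mul_nonneg (by linarith [ha n]) hs0))
    have h5 : C n ≤ 1 := normalizer_le_one (lam := lam n) (a := a n) (m := d n)
    exact mul_le_one₀ (mul_le_one₀ (mul_le_one₀ h5 (Real.exp_pos _).le h2)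
      (Real.exp_pos _).le h3) (Real.rpow_nonneg hd0.le _) h4
  · have hXM0 : 0 < Xnorm (X n) * M0 := mul_pos hX hM0
    have hM : 0 < Mconst M0 (X n) := hXM0.trans_le hXM
    have hlam : 0 < lam n := (div_pos hM hd0).trans_le (hL0 n).1
    refine (priorMeasure_suppBox_ge (by omega) (βstar n) (a := a n) hlam (hCpos n)).trans
      (measure_mono fun β hβ => hsub β ?_)
    have hl := l1_sub_le_of_mem_suppBox hβ
    rw [← hs] at hl
    have hl0 : 0 ≤ l1 (β - βstar n) := Finset.sum_nonneg fun _ _ => abs_nonneg _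
    have hbound : M0 * Xnorm (X n) * l1 (β - βstar n) ≤ s / d n := by
      have h1 : M0 * Xnorm (X n) ≤ lam n * d n := by
        rw [mul_comm M0]
        exact hXM.trans ((div_le_iff₀ hd0).1 (hL0 n).1)
      calc M0 * Xnorm (X n) * l1 (β - βstar n)
          ≤ lam n * d n * (s * ((lam n)⁻¹ * ((d n : ℝ) ^ 2)⁻¹)) := by gcongr
        _ = s / d n := by field_simp
    calc n / 2 * (M0 * Xnorm (X n) * l1 (β - βstar n)) ^ 2
        ≤ (d n : ℝ) / 2 * ((s : ℝ) / d n) ^ 2 := by gcongr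
      _ = (s : ℝ) * ((s : ℝ) / d n / 2) := by field_simp
      _ ≤ s * Real.log (d n) := by
        have : (s : ℝ) / d n ≤ 1 := (div_le_one hd0).2 hsd
        gcongr
        linarith
end
end

section
/- Prior integral over large models is geometrically small (inequality (B8)). Let Π_n be the spike-and-Laplace prior on ℝ^{d_n}: Π_n(β) = Σ_{S ⊆ {1,…,d_n}} C_n binom(d_n,|S|)^{-1} (λ_n/(2 d_n^{a_n}))^{|S|} exp(−λ_n ||β_S||₁) δ_0(β_{S^c}), with λ_n > 0, a_n > 0, and normalizer C_n > 0. Then for every β* ∈ ℝ^{d_n} and every real ε ≥ 0, ∫_{ { β : |supp(β)| > ε } } exp( −(λ_n/4) ||β − β*||₁ + λ_n ||β||₁ ) dΠ_n(β) ≤ C_n Σ_{ s integer, ε < s ≤ d_n } ( 4 d_n^{−a_n} )^{s}. -/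
open MeasureTheory

noncomputable section

open ProbabilityTheory

lemma lintegral_exp_neg_mul_abs_sub {c : ℝ} (hc : 0 < c) (t : ℝ) :
    ∫⁻ x : ℝ, ENNReal.ofReal (Real.exp (-(c * |x - t|))) = ENNReal.ofReal (2 / c) := by
  rw [lintegral_sub_right_eq_self (fun x : ℝ => ENNReal.ofReal (Real.exp (-(c * |x|)))) t]
  have hint : ∫ x : ℝ, Real.exp (-(c * |x|)) = 2 / c := by
    rw [integral_comp_abs (f := fun x => Real.exp (-(c * x)))]
    have h := integral_exp_mul_Ioi (a := -c) (by linarith) 0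
    simp only [neg_mul, mul_zero, Real.exp_zero] at h
    rw [h]
    field_simp
  rw [← hint, ofReal_integral_eq_lintegral_ofReal _ (ae_of_all _ fun x => (Real.exp_pos _).le)]
  refine Integrable.of_integral_ne_zero ?_
  rw [hint]
  positivity

lemma lintegral_laplaceMeasure {lam : ℝ} {g : ℝ → ENNReal} (hg : Measurable g) :
    ∫⁻ x, g x ∂(laplaceMeasure lam) =
      ∫⁻ x, ENNReal.ofReal (lam / 2 * Real.exp (-(lam * |x|))) * g x := by
  rw [laplaceMeasure, lintegral_withDensity_eq_lintegral_mul _ (by fun_prop) hg]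
  rfl

lemma isProbabilityMeasure_laplaceMeasure {lam : ℝ} (hlam : 0 < lam) :
    IsProbabilityMeasure (laplaceMeasure lam) := by
  constructor
  rw [← lintegral_one, lintegral_laplaceMeasure measurable_const]
  have h := lintegral_exp_neg_mul_abs_sub hlam 0
  simp only [sub_zero] at h
  simp_rw [mul_one, ENNReal.ofReal_mul (by positivity : 0 ≤ lam / 2)]
  rw [lintegral_const_mul _ (by fun_prop), h, ← ENNReal.ofReal_mul (by positivity)]
  field_simp
  simp

lemma lintegral_tilt_laplaceMeasure {lam : ℝ} (hlam : 0 < lam) (t : ℝ) :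
    ∫⁻ x, ENNReal.ofReal (Real.exp (-(lam / 4) * |x - t| + lam * |x|)) ∂(laplaceMeasure lam)
      = 4 := by
  rw [lintegral_laplaceMeasure (by fun_prop)]
  have h (x : ℝ) : ENNReal.ofReal (lam / 2 * Real.exp (-(lam * |x|))) *
        ENNReal.ofReal (Real.exp (-(lam / 4) * |x - t| + lam * |x|)) =
      ENNReal.ofReal (lam / 2) * ENNReal.ofReal (Real.exp (-(lam / 4 * |x - t|))) := by
    rw [← ENNReal.ofReal_mul (by positivity), ← ENNReal.ofReal_mul (by positivity), mul_assoc,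
      ← Real.exp_add]
    ring_nf
  simp_rw [h]
  rw [lintegral_const_mul _ (by fun_prop), lintegral_exp_neg_mul_abs_sub (by positivity),
    ← ENNReal.ofReal_mul (by positivity),
    show lam / 2 * (2 / (lam / 4)) = 4 by field_simp]
  simp

lemma lintegral_pi_prod {ι : Type*} [Fintype ι] (μ : ι → Measure ℝ)
    [∀ i, IsProbabilityMeasure (μ i)] (f : ι → ℝ → ENNReal) (hf : ∀ i, Measurable (f i)) :
    ∫⁻ x, ∏ i, f i (x i) ∂(Measure.pi μ) = ∏ i, ∫⁻ x, f i x ∂(μ i) := by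
  rw [lintegral_prod_eq_prod_lintegral_of_indepFun Finset.univ (fun i (x : ι → ℝ) => f i (x i))
    (iIndepFun_pi fun i => (hf i).aemeasurable)
    (fun i => (hf i).comp (measurable_pi_apply i))]
  exact Finset.prod_congr rfl fun i _ =>
    (measurePreserving_eval μ i).lintegral_comp (hf i)

lemma lintegral_tilt_modelMeasure_le {dn : ℕ} {lam : ℝ} (hlam : 0 < lam)
    (βstar : Fin dn → ℝ) (S : Finset (Fin dn)) :
    ∫⁻ β, ENNReal.ofReal (Real.exp (-(lam / 4) * l1 (β - βstar) + lam * l1 β))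
        ∂(modelMeasure dn lam S) ≤ 4 ^ S.card := by
  have := isProbabilityMeasure_laplaceMeasure hlam
  have hprob (j : Fin dn) :
      IsProbabilityMeasure (if j ∈ S then laplaceMeasure lam else Measure.dirac 0) := by
    split_ifs <;> infer_instance
  have hprod (β : Fin dn → ℝ) :
      ENNReal.ofReal (Real.exp (-(lam / 4) * l1 (β - βstar) + lam * l1 β)) =
        ∏ j, ENNReal.ofReal
          (Real.exp (-(lam / 4) * |β j - βstar j| + lam * |β j|)) := by
    rw [← ENNReal.ofReal_prod_of_nonneg fun _ _ => (Real.exp_pos _).le, ← Real.exp_sum,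
      Finset.sum_add_distrib, ← Finset.mul_sum, ← Finset.mul_sum]
    rfl
  simp_rw [hprod, modelMeasure]
  rw [lintegral_pi_prod _
    (fun j x => ENNReal.ofReal (Real.exp (-(lam / 4) * |x - βstar j| + lam * |x|)))
    fun j => by fun_prop]
  calc _ ≤ ∏ j : Fin dn, (if j ∈ S then (4 : ENNReal) else 1) := by
        refine Finset.prod_le_prod' fun j _ => ?_
        split_ifs
        · exact (lintegral_tilt_laplaceMeasure hlam _).le
        · rw [lintegral_dirac' _ (by fun_prop), ENNReal.ofReal_le_one, Real.exp_le_one_iff]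
          simp only [abs_zero, mul_zero, add_zero]
          have := abs_nonneg (0 - βstar j)
          nlinarith
    _ = 4 ^ S.card := by simp

lemma ae_suppSet_subset_modelMeasure {dn : ℕ} {lam : ℝ} (hlam : 0 < lam)
    (S : Finset (Fin dn)) :
    ∀ᵐ β ∂(modelMeasure dn lam S), suppSet β ⊆ S := by
  have := isProbabilityMeasure_laplaceMeasure hlam
  have hprob (j : Fin dn) :
      IsProbabilityMeasure (if j ∈ S then laplaceMeasure lam else Measure.dirac 0) := by
    split_ifs <;> infer_instance
  have h : ∀ᵐ β ∂(modelMeasure dn lam S), ∀ j, j ∉ S → β j = 0 := by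
    rw [ae_all_iff]
    intro j
    refine Measure.tendsto_eval_ae_ae.eventually (p := fun x : ℝ => j ∉ S → x = 0) ?_
    by_cases hj : j ∈ S
    · simp [hj]
    · simp [hj, ae_dirac_eq]
  filter_upwards [h] with β hβ j hj
  by_contra hjS
  simp [suppSet, hβ j hjS] at hj

lemma setLIntegral_tilt_modelMeasure_le {dn : ℕ} {lam : ℝ} (hlam : 0 < lam)
    (βstar : Fin dn → ℝ) (S : Finset (Fin dn)) (ε : ℝ) :
    ∫⁻ β in {β : Fin dn → ℝ | ε < ((suppSet β).card : ℝ)},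
        ENNReal.ofReal (Real.exp (-(lam / 4) * l1 (β - βstar) + lam * l1 β))
        ∂(modelMeasure dn lam S) ≤ if ε < (S.card : ℝ) then 4 ^ S.card else 0 := by
  split_ifs with hS
  · exact (setLIntegral_le_lintegral _ _).trans (lintegral_tilt_modelMeasure_le hlam βstar S)
  · refine (setLIntegral_measure_zero _ _ (measure_eq_zero_iff_ae_notMem.2 ?_)).le
    filter_upwards [ae_suppSet_subset_modelMeasure hlam S] with β hβ hmem
    have : ((suppSet β).card : ℝ) ≤ S.card := by exact_mod_cast Finset.card_le_card hβ
    exact hS (lt_of_lt_of_le hmem this)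

lemma measurableSet_lt_card_suppSet {m : ℕ} (ε : ℝ) :
    MeasurableSet {β : Fin m → ℝ | ε < ((suppSet β).card : ℝ)} := by
  have h (β : Fin m → ℝ) : ((suppSet β).card : ℝ) = ∑ j, if β j = 0 then 0 else 1 := by
    simp [suppSet, Finset.sum_ite]
  simp_rw [h]
  refine measurableSet_lt measurable_const (Finset.measurable_sum _ fun j _ => ?_)
  exact Measurable.ite (measurable_pi_apply j (measurableSet_singleton 0))
    measurable_const measurable_const

lemma sum_model_weights (dn : ℕ) (C q ε : ℝ) :
    ∑ S : Finset (Fin dn), C * ((dn.choose S.card : ℝ))⁻¹ * q ^ S.card *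
        (if ε < (S.card : ℝ) then 4 ^ S.card else 0) =
      C * ∑ s ∈ Finset.range (dn + 1), (if ε < (s : ℝ) then (4 * q) ^ s else 0) := by
  rw [← Finset.powerset_univ, Finset.sum_powerset_apply_card (fun s =>
    C * ((dn.choose s : ℝ))⁻¹ * q ^ s * (if ε < (s : ℝ) then 4 ^ s else 0)), Finset.mul_sum,
    Finset.card_univ, Fintype.card_fin]
  refine Finset.sum_congr rfl fun s hs => ?_
  have : (dn.choose s : ℝ) ≠ 0 := by
    exact_mod_cast (Nat.choose_pos (Nat.lt_succ_iff.1 (Finset.mem_range.1 hs))).ne'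
  rw [nsmul_eq_mul]
  split_ifs
  · rw [mul_pow]
    field_simp
  · simp

/-- The prior integral over large models is geometrically small (inequality (B8)). -/
theorem prior_integral_large_models (dn : ℕ) (lam a C : ℝ)
    (hlam : 0 < lam) (ha : 0 < a) (hC : 0 < C)
    (βstar : Fin dn → ℝ) (ε : ℝ) (hε : 0 ≤ ε) :
    (∫ β in {β : Fin dn → ℝ | ε < ((suppSet β).card : ℝ)},
        Real.exp (-(lam / 4) * l1 (β - βstar) + lam * l1 β)
        ∂(priorMeasure dn lam a C)) ≤
      C * ∑ s ∈ Finset.range (dn + 1),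
        (if ε < (s : ℝ) then (4 * (dn : ℝ) ^ (-a)) ^ s else 0) := by
  have hA := measurableSet_lt_card_suppSet (m := dn) ε
  rw [integral_eq_lintegral_of_nonneg_ae (ae_of_all _ fun β => (Real.exp_pos _).le)
    (Continuous.aestronglyMeasurable (by simp only [l1, Pi.sub_apply]; fun_prop)),
    ← sum_model_weights]
  refine ENNReal.toReal_le_of_le_ofReal
    (Finset.sum_nonneg fun S _ => mul_nonneg (by positivity) (by split_ifs <;> positivity)) ?_
  rw [ENNReal.ofReal_sum_of_nonneg
    (fun S _ => mul_nonneg (by positivity) (by split_ifs <;> positivity)),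
    ← lintegral_indicator hA, priorMeasure, lintegral_finsetSum_measure]
  refine Finset.sum_le_sum fun S _ => ?_
  rw [lintegral_smul_measure, lintegral_indicator hA, smul_eq_mul,
    ENNReal.ofReal_mul (p := _ * _ ^ S.card) (q := ite _ _ _) (by positivity)]
  refine mul_le_mul' le_rfl ((setLIntegral_tilt_modelMeasure_le hlam βstar S ε).trans_eq ?_)
  split_ifs <;> simp [ENNReal.ofReal_pow]
end
end
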